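/- arXiv:2404.09250 — 2 statements merged into one kernel-verified Lean document; each statement's English description precedes it below -/
import Mathlib

section
/- Let x, y ∈ M_n(ℂ) be positive semidefinite, let z ∈ M_n(ℂ), and let t ∈ [1/2, 1]. Set B_t = x^t z y^{1-t} + y^t z* x^{1-t} and F_t = y^{1-t} z* x^{2t-1} z y^{1-t} + x^{1-t} z y^{2t-1} z* x^{1-t}. Then there exists a contraction c ∈ M_n(ℂ) (i.e., with operator norm ‖c‖ ≤ 1) such that B_t = (x+y)^{1/2} c F_t^{1/2}. -/
open scoped Matrix ComplexOrder

/-- The real power `A^s` of a positive semidefinite matrix, defined via the spectral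
decomposition (equivalently, the continuous functional calculus), with the convention
`A^0 = 1`.  (If `A` is not Hermitian we return the junk value `0`.) -/
noncomputable def psdPow {N : ℕ} (A : Matrix (Fin N) (Fin N) ℂ) (s : ℝ) :
    Matrix (Fin N) (Fin N) ℂ :=
  if hA : A.IsHermitian then
    (Matrix.IsHermitian.eigenvectorUnitary hA : Matrix (Fin N) (Fin N) ℂ) *
      Matrix.diagonal (fun i => ((hA.eigenvalues i ^ s : ℝ) : ℂ)) *
      (Matrix.IsHermitian.eigenvectorUnitary hA : Matrix (Fin N) (Fin N) ℂ)ᴴ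
  else 0

theorem conjTranspose_psdPow {N : ℕ} (A : Matrix (Fin N) (Fin N) ℂ) (s : ℝ) :
    (psdPow A s)ᴴ = psdPow A s := by
  unfold psdPow
  split_ifs with hA
  · simp only [Matrix.conjTranspose_mul, Matrix.conjTranspose_conjTranspose,
      Matrix.diagonal_conjTranspose, Matrix.mul_assoc]
    congr 3
    ext i
    simp
  · simp

theorem psdPow_mul_psdPow {N : ℕ} {A : Matrix (Fin N) (Fin N) ℂ} (hA : A.PosSemidef)
    {r s q : ℝ} (h : ∀ a : ℝ, 0 ≤ a → a ^ r * a ^ s = a ^ q) :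
    psdPow A r * psdPow A s = psdPow A q := by
  have hU : (hA.1.eigenvectorUnitary : Matrix (Fin N) (Fin N) ℂ)ᴴ *
      (hA.1.eigenvectorUnitary : Matrix (Fin N) (Fin N) ℂ) = 1 :=
    Unitary.coe_star_mul_self hA.1.eigenvectorUnitary
  simp only [psdPow, dif_pos hA.1, ← h _ (hA.eigenvalues_nonneg _), Complex.ofReal_mul]
  rw [← Matrix.diagonal_mul_diagonal]
  simp only [Matrix.mul_assoc]
  rw [← Matrix.mul_assoc _ᴴ, hU, Matrix.one_mul]

theorem psdPow_one {N : ℕ} {A : Matrix (Fin N) (Fin N) ℂ} (hA : A.IsHermitian) :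
    psdPow A 1 = A := by
  conv_rhs => rw [hA.spectral_theorem]
  simp only [psdPow, dif_pos hA, Real.rpow_one]
  rfl

theorem psdPow_add {N : ℕ} {A : Matrix (Fin N) (Fin N) ℂ} (hA : A.PosSemidef)
    {r s : ℝ} (hr : 0 ≤ r) (hs : 0 ≤ s) :
    psdPow A r * psdPow A s = psdPow A (r + s) :=
  psdPow_mul_psdPow hA fun _ ha => (Real.rpow_add_of_nonneg ha hr hs).symm

theorem psdPow_half_mul_half {N : ℕ} {A : Matrix (Fin N) (Fin N) ℂ} (hA : A.PosSemidef) :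
    psdPow A (1 / 2) * psdPow A (1 / 2) = A := by
  rw [psdPow_add hA (by norm_num) (by norm_num), add_halves, psdPow_one hA.1]

theorem psdPow_neg_half_mul_self {N : ℕ} {A : Matrix (Fin N) (Fin N) ℂ} (hA : A.PosSemidef) :
    psdPow A (-(1 / 2)) * A = psdPow A (1 / 2) := by
  nth_rewrite 2 [← psdPow_one hA.1]
  refine psdPow_mul_psdPow hA fun a ha => ?_
  rcases ha.eq_or_lt with rfl | ha
  · norm_num [Real.zero_rpow]
  · rw [← Real.rpow_add ha]
    norm_num

open scoped Matrix.Norms.L2Operator in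
/-- Polar decomposition of a rectangular matrix, with a contraction in place of a partial
isometry. -/
theorem exists_contraction_mul_psdPow_half {m : Type*} [Fintype m] [DecidableEq m] {N : ℕ}
    (C : Matrix m (Fin N) ℂ) :
    ∃ V : Matrix m (Fin N) ℂ, ‖V‖ ≤ 1 ∧ C = V * psdPow (Cᴴ * C) (1 / 2) := by
  have hA : (Cᴴ * C).PosSemidef := Matrix.posSemidef_conjTranspose_mul_self C
  set A := Cᴴ * C with hAdef
  set P := psdPow A (1 / 2)
  set M := psdPow A (-(1 / 2))
  have hP : Pᴴ = P := conjTranspose_psdPow _ _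
  have hM : Mᴴ = M := conjTranspose_psdPow _ _
  have hPP : P * P = A := psdPow_half_mul_half hA
  have hMA : M * A = P := psdPow_neg_half_mul_self hA
  have hAM : A * M = P := by
    simpa [hP, hM, hA.1.eq] using congrArg Matrix.conjTranspose hMA
  have hcomm : M * P = P * M := by rw [← hAM, ← Matrix.mul_assoc, hMA, hAM]
  refine ⟨C * M, ?_, ?_⟩
  · have hE : (C * M)ᴴ * (C * M) = P * M := by
      rw [Matrix.conjTranspose_mul, hM, Matrix.mul_assoc, ← Matrix.mul_assoc Cᴴ, ← hAdef,
        ← Matrix.mul_assoc, hMA]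
    have hEH : (P * M)ᴴ = P * M := by rw [Matrix.conjTranspose_mul, hP, hM, hcomm]
    have hEE : (P * M)ᴴ * (P * M) = P * M := by
      rw [hEH]
      nth_rewrite 1 [← hcomm]
      rw [Matrix.mul_assoc, ← Matrix.mul_assoc P, hPP, hAM, hcomm]
    have h1 := Matrix.l2_opNorm_conjTranspose_mul_self (C * M)
    have h2 := Matrix.l2_opNorm_conjTranspose_mul_self (P * M)
    rw [hE] at h1
    rw [hEE] at h2
    have h3 : ‖P * M‖ ≤ 1 := by nlinarith [norm_nonneg (P * M)]
    nlinarith [norm_nonneg (C * M)]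
  · have hz : A * (1 - M * P) = 0 := by
      rw [Matrix.mul_sub, Matrix.mul_one, ← Matrix.mul_assoc, hAM, hPP, sub_self]
    have h0 : C * (1 - M * P) = 0 := by
      rw [← Matrix.conjTranspose_mul_self_eq_zero, Matrix.conjTranspose_mul, Matrix.mul_assoc,
        ← Matrix.mul_assoc Cᴴ, ← hAdef, hz, Matrix.mul_zero]
    rw [Matrix.mul_sub, Matrix.mul_one, sub_eq_zero, ← Matrix.mul_assoc] at h0
    exact h0

open scoped Matrix.Norms.L2Operator in
theorem exists_contraction_conjTranspose_mul {m : Type*} [Fintype m] [DecidableEq m] {N : ℕ}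
    (R C : Matrix m (Fin N) ℂ) :
    ∃ c : Matrix (Fin N) (Fin N) ℂ, ‖Matrix.toEuclideanCLM (𝕜 := ℂ) c‖ ≤ 1 ∧
      Rᴴ * C = psdPow (Rᴴ * R) (1 / 2) * c * psdPow (Cᴴ * C) (1 / 2) := by
  obtain ⟨U, hU, hUeq⟩ := exists_contraction_mul_psdPow_half R
  obtain ⟨V, hV, hVeq⟩ := exists_contraction_mul_psdPow_half C
  refine ⟨Uᴴ * V, ?_, ?_⟩
  · rw [← Matrix.cstar_norm_def]
    calc ‖Uᴴ * V‖ ≤ ‖Uᴴ‖ * ‖V‖ := Matrix.l2_opNorm_mul _ _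
      _ = ‖U‖ * ‖V‖ := by rw [Matrix.l2_opNorm_conjTranspose]
      _ ≤ 1 := mul_le_one₀ hU (norm_nonneg _) hV
  · have hR := congrArg Matrix.conjTranspose hUeq
    rw [Matrix.conjTranspose_mul, conjTranspose_psdPow] at hR
    nth_rewrite 1 [hR, hVeq]
    simp only [Matrix.mul_assoc]

theorem stmt4 {n : ℕ} (x y : Matrix (Fin n) (Fin n) ℂ)
    (hx : x.PosSemidef) (hy : y.PosSemidef)
    (z : Matrix (Fin n) (Fin n) ℂ)
    (t : ℝ) (ht : t ∈ Set.Icc (1/2 : ℝ) 1) :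
    ∃ c : Matrix (Fin n) (Fin n) ℂ,
      ‖Matrix.toEuclideanCLM (𝕜 := ℂ) c‖ ≤ 1 ∧
      psdPow x t * z * psdPow y (1 - t) + psdPow y t * zᴴ * psdPow x (1 - t) =
        psdPow (x + y) (1/2) * c *
          psdPow (psdPow y (1 - t) * zᴴ * psdPow x (2*t - 1) * z * psdPow y (1 - t) +
      psdPow x (1 - t) * z * psdPow y (2*t - 1) * zᴴ * psdPow x (1 - t)) (1/2) := by
  obtain ⟨ht1, ht2⟩ := ht
  have hs : 0 ≤ t - 1 / 2 := sub_nonneg.2 ht1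
  have split {A : Matrix (Fin n) (Fin n) ℂ} (hA : A.PosSemidef) :
      psdPow A (1 / 2) * psdPow A (t - 1 / 2) = psdPow A t := by
    rw [psdPow_add hA (by norm_num) hs]
    congr 1
    ring
  have square {A : Matrix (Fin n) (Fin n) ℂ} (hA : A.PosSemidef) :
      psdPow A (t - 1 / 2) * psdPow A (t - 1 / 2) = psdPow A (2 * t - 1) := by
    rw [psdPow_add hA hs hs]
    congr 1
    ring
  obtain ⟨c, hc, h⟩ := exists_contraction_conjTranspose_mul
    (Matrix.fromRows (psdPow x (1 / 2)) (psdPow y (1 / 2)))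
    (Matrix.fromRows (psdPow x (t - 1 / 2) * z * psdPow y (1 - t))
      (psdPow y (t - 1 / 2) * zᴴ * psdPow x (1 - t)))
  refine ⟨c, hc, ?_⟩
  simpa only [Matrix.conjTranspose_fromRows_eq_fromCols_conjTranspose,
    Matrix.fromCols_mul_fromRows, Matrix.conjTranspose_mul, conjTranspose_psdPow,
    Matrix.conjTranspose_conjTranspose, psdPow_half_mul_half hx, psdPow_half_mul_half hy,
    ← split hx, ← split hy, ← square hx, ← square hy, Matrix.mul_assoc] using h
end

section
/- Let x, y ∈ M_n(ℂ) be positive semidefinite, let z ∈ M_n(ℂ), let t ∈ [1/2, 1], and let |||·||| be any unitarily invariant norm on M_n(ℂ). Set B_t = x^t z y^{1-t} + y^t z* x^{1-t} and F_t = y^{1-t} z* x^{2t-1} z y^{1-t} + x^{1-t} z y^{2t-1} z* x^{1-t}. Then |||B_t||| ≤ |||x+y|||^{1/2} · |||F_t|||^{1/2}, provided ‖z‖ ≤ 1 (z a contraction in operator norm). -/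
open scoped Matrix ComplexOrder

section PsdPow

variable {n : ℕ} {x : Matrix (Fin n) (Fin n) ℂ}

theorem psdPow_conjTranspose (x : Matrix (Fin n) (Fin n) ℂ) (s : ℝ) :
    (psdPow x s)ᴴ = psdPow x s := by
  unfold psdPow
  split_ifs with h
  · simp only [Matrix.conjTranspose_mul, Matrix.conjTranspose_conjTranspose,
      Matrix.diagonal_conjTranspose, Matrix.mul_assoc]
    congr 3
    ext i
    simp
  · simp

theorem psdPow_mul_psdPow_s6 (hx : x.PosSemidef) {s r : ℝ} (hs : 0 ≤ s) (hr : 0 ≤ r) :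
    psdPow x s * psdPow x r = psdPow x (s + r) := by
  have hU : (hx.1.eigenvectorUnitary : Matrix (Fin n) (Fin n) ℂ)ᴴ *
      (hx.1.eigenvectorUnitary : Matrix (Fin n) (Fin n) ℂ) = 1 :=
    Unitary.coe_star_mul_self hx.1.eigenvectorUnitary
  simp only [psdPow, dif_pos hx.1]
  calc _ = (hx.1.eigenvectorUnitary : Matrix (Fin n) (Fin n) ℂ) *
      (Matrix.diagonal (fun i => ((hx.1.eigenvalues i ^ s : ℝ) : ℂ)) *
      ((hx.1.eigenvectorUnitary : Matrix (Fin n) (Fin n) ℂ)ᴴ *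
      (hx.1.eigenvectorUnitary : Matrix (Fin n) (Fin n) ℂ)) *
      Matrix.diagonal (fun i => ((hx.1.eigenvalues i ^ r : ℝ) : ℂ))) *
      (hx.1.eigenvectorUnitary : Matrix (Fin n) (Fin n) ℂ)ᴴ := by
        simp only [Matrix.mul_assoc]
    _ = _ := by
      rw [hU, Matrix.mul_one, Matrix.diagonal_mul_diagonal]
      congr 3
      ext i
      rw [Real.rpow_add_of_nonneg (hx.eigenvalues_nonneg i) hs hr, Complex.ofReal_mul]

theorem psdPow_one_s6 (hx : x.PosSemidef) : psdPow x 1 = x := by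
  conv_rhs => rw [hx.1.spectral_theorem]
  simp only [psdPow, dif_pos hx.1, Real.rpow_one]
  rfl

end PsdPow

section UnitarilyInvariant

open scoped MatrixOrder Matrix.Norms.L2Operator

variable {n : ℕ}

theorem Matrix.exists_unitary_posSemidef_of_isUnit {X : Matrix (Fin n) (Fin n) ℂ}
    (hX : IsUnit X) : ∃ U ∈ Matrix.unitaryGroup (Fin n) ℂ, (Uᴴ * X).PosSemidef := by
  set S := CFC.sqrt (Xᴴ * X)
  have hpsd : 0 ≤ Xᴴ * X := (Matrix.posSemidef_conjTranspose_mul_self X).nonneg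
  have hS : S.PosSemidef := Matrix.nonneg_iff_posSemidef.mp (CFC.sqrt_nonneg (Xᴴ * X))
  have hSS : S * S = Xᴴ * X := CFC.sqrt_mul_sqrt_self (Xᴴ * X) hpsd
  have hdet : IsUnit X.det := (Matrix.isUnit_iff_isUnit_det X).mp hX
  have hSdet : IsUnit S.det := by
    have : IsUnit (S.det * S.det) := by
      rw [← Matrix.det_mul, hSS, Matrix.det_mul, Matrix.det_conjTranspose]
      exact hdet.star.mul hdet
    exact isUnit_of_mul_isUnit_left this
  have hSi : (S⁻¹)ᴴ = S⁻¹ := by rw [Matrix.conjTranspose_nonsing_inv, hS.1.eq]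
  have hUX : (X * S⁻¹)ᴴ * X = S := by
    rw [Matrix.conjTranspose_mul, hSi, Matrix.mul_assoc, ← hSS, ← Matrix.mul_assoc,
      Matrix.nonsing_inv_mul _ hSdet, Matrix.one_mul]
  refine ⟨X * S⁻¹, ?_, by rwa [hUX]⟩
  rw [Matrix.mem_unitaryGroup_iff', Matrix.star_eq_conjTranspose, ← Matrix.mul_assoc, hUX,
    Matrix.mul_nonsing_inv _ hSdet]

theorem Matrix.exists_pos_lt_isUnit_add_smul_one (X : Matrix (Fin n) (Fin n) ℂ) {ε : ℝ}
    (hε : 0 < ε) : ∃ δ : ℝ, 0 < δ ∧ δ < ε ∧ IsUnit (X + (δ : ℂ) • 1) := by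
  by_contra! h
  have hsub : ((↑) : ℝ → ℂ) '' Set.Ioo 0 ε ⊆ spectrum ℂ (-X) := by
    rintro _ ⟨δ, hδ, rfl⟩
    rw [spectrum.mem_iff, Algebra.algebraMap_eq_smul_one, sub_neg_eq_add, add_comm]
    exact h δ hδ.1 hδ.2
  exact ((Set.Ioo_infinite hε).image Complex.ofReal_injective.injOn)
    ((Matrix.finite_spectrum (-X)).subset hsub)

variable {N : Matrix (Fin n) (Fin n) ℂ → ℝ}

theorem unitarilyInvariant_selfAdjoint_contraction_mul_le
    (hN_add : ∀ A B, N (A + B) ≤ N A + N B)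
    (hN_smul : ∀ (c : ℂ) A, N (c • A) = ‖c‖ * N A)
    (hN_unitary : ∀ (A U V : Matrix (Fin n) (Fin n) ℂ),
      U ∈ Matrix.unitaryGroup (Fin n) ℂ → V ∈ Matrix.unitaryGroup (Fin n) ℂ →
      N (U * A * V) = N A)
    {H : Matrix (Fin n) (Fin n) ℂ} (hH : IsSelfAdjoint H) (hle : ‖H‖ ≤ 1)
    (M V : Matrix (Fin n) (Fin n) ℂ) (hV : V ∈ Matrix.unitaryGroup (Fin n) ℂ) :
    N (V * H * M) ≤ N M ∧ N (M * H * V) ≤ N M := by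
  set W := H + Complex.I • CFC.sqrt (1 - H ^ 2)
  have hW : W ∈ Matrix.unitaryGroup (Fin n) ℂ :=
    hH.self_add_I_smul_cfcSqrt_sub_sq_mem_unitary H hle
  have hW' : star W ∈ Matrix.unitaryGroup (Fin n) ℂ := Unitary.star_mem hW
  have hsum : H = (1 / 2 : ℂ) • (W + star W) := by
    have hs : star (CFC.sqrt (1 - H ^ 2)) = CFC.sqrt (1 - H ^ 2) :=
      (CFC.sqrt_nonneg (1 - H ^ 2)).isSelfAdjoint
    simp only [W, star_add, star_smul, hH.star_eq, hs]
    simp only [RCLike.star_def, Complex.conj_I]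
    module
  have h1 : (1 : Matrix (Fin n) (Fin n) ℂ) ∈ Matrix.unitaryGroup (Fin n) ℂ := one_mem _
  have hhalf : ‖(1 / 2 : ℂ)‖ = 1 / 2 := by norm_num
  constructor
  · have e : V * H * M = (1 / 2 : ℂ) • ((V * W) * M * 1 + (V * star W) * M * 1) := by
      rw [hsum]
      simp only [Matrix.mul_one, Matrix.mul_smul, Matrix.smul_mul, Matrix.mul_add, Matrix.add_mul]
    rw [e, hN_smul, hhalf]
    have := hN_add ((V * W) * M * 1) ((V * star W) * M * 1)
    rw [hN_unitary _ _ _ (mul_mem hV hW) h1, hN_unitary _ _ _ (mul_mem hV hW') h1] at this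
    linarith
  · have e : M * H * V = (1 / 2 : ℂ) • (1 * M * (W * V) + 1 * M * (star W * V)) := by
      rw [hsum]
      simp only [Matrix.one_mul, Matrix.mul_smul, Matrix.smul_mul, Matrix.mul_add, Matrix.add_mul,
        Matrix.mul_assoc]
    rw [e, hN_smul, hhalf]
    have := hN_add (1 * M * (W * V)) (1 * M * (star W * V))
    rw [hN_unitary _ _ _ h1 (mul_mem hW hV), hN_unitary _ _ _ h1 (mul_mem hW' hV)] at this
    linarith

theorem unitarilyInvariant_le_of_posDef
    (hN_add : ∀ A B, N (A + B) ≤ N A + N B)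
    (hN_smul : ∀ (c : ℂ) A, N (c • A) = ‖c‖ * N A)
    (hN_unitary : ∀ (A U V : Matrix (Fin n) (Fin n) ℂ),
      U ∈ Matrix.unitaryGroup (Fin n) ℂ → V ∈ Matrix.unitaryGroup (Fin n) ℂ →
      N (U * A * V) = N A)
    {A B : Matrix (Fin n) (Fin n) ℂ} (hA : A.PosDef) (hB : B.PosDef) (hAB : (B - A).PosSemidef) :
    N A ≤ N B := by
  set R := CFC.sqrt A
  set S := CFC.sqrt B
  have hR : R.PosSemidef := Matrix.nonneg_iff_posSemidef.mp (CFC.sqrt_nonneg A)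
  have hS : S.PosSemidef := Matrix.nonneg_iff_posSemidef.mp (CFC.sqrt_nonneg B)
  have hRR : R * R = A := CFC.sqrt_mul_sqrt_self A hA.posSemidef.nonneg
  have hSS : S * S = B := CFC.sqrt_mul_sqrt_self B hB.posSemidef.nonneg
  have hRu : IsUnit R.det := by
    have : IsUnit (R.det * R.det) := by
      rw [← Matrix.det_mul, hRR]; exact hA.det_pos.ne'.isUnit
    exact isUnit_of_mul_isUnit_left this
  have hSu : IsUnit S.det := by
    have : IsUnit (S.det * S.det) := by
      rw [← Matrix.det_mul, hSS]; exact hB.det_pos.ne'.isUnit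
    exact isUnit_of_mul_isUnit_left this
  have hSi : (S⁻¹)ᴴ = S⁻¹ := by rw [Matrix.conjTranspose_nonsing_inv, hS.1.eq]
  have hSinv : S⁻¹ * S = 1 := Matrix.nonsing_inv_mul _ hSu
  have hSinv' : S * S⁻¹ = 1 := Matrix.mul_nonsing_inv _ hSu
  set K := R * S⁻¹
  have hKS : K * S = R := by rw [Matrix.mul_assoc, hSinv, Matrix.mul_one]
  have hK : IsUnit K := by
    rw [Matrix.isUnit_iff_isUnit_det]
    have : IsUnit (K.det * S.det) := by rw [← Matrix.det_mul, hKS]; exact hRu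
    exact isUnit_of_mul_isUnit_left this
  obtain ⟨U, hU, hH⟩ := Matrix.exists_unitary_posSemidef_of_isUnit hK
  set H := Uᴴ * K
  have hUU : U * Uᴴ = 1 := Matrix.mem_unitaryGroup_iff.mp hU
  have hUH : U * H = K := by rw [← Matrix.mul_assoc, hUU, Matrix.one_mul]
  have hHU : H * Uᴴ = Kᴴ := by rw [← hUH, Matrix.conjTranspose_mul, hH.1.eq]
  have hU' : Uᴴ ∈ Matrix.unitaryGroup (Fin n) ℂ := Unitary.star_mem hU
  have hHH : H * H = S⁻¹ * A * S⁻¹ := by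
    have h1 : H * H = Kᴴ * K := by
      calc H * H = H * (Uᴴ * K) := rfl
        _ = Kᴴ * K := by rw [← Matrix.mul_assoc, hHU]
    rw [h1, Matrix.conjTranspose_mul, hSi, hR.1.eq, ← hRR]
    simp only [K, Matrix.mul_assoc]
  have hHle : H * H ≤ 1 := by
    rw [Matrix.le_iff]
    have h2 : 1 - H * H = S⁻¹ * (B - A) * (S⁻¹)ᴴ := by
      rw [hHH, hSi, Matrix.mul_sub, Matrix.sub_mul, ← hSS, ← Matrix.mul_assoc, hSinv,
        Matrix.one_mul, hSinv']
    rw [h2]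
    exact hAB.mul_mul_conjTranspose_same _
  have hsa : IsSelfAdjoint H := hH.1
  have hnorm : ‖H‖ ≤ 1 := by
    have hn : (0 : Matrix (Fin n) (Fin n) ℂ) ≤ H * H := by
      have := Matrix.posSemidef_conjTranspose_mul_self H
      rw [hH.1.eq] at this
      exact this.nonneg
    have h3 := (CStarAlgebra.norm_le_one_iff_of_nonneg (H * H) hn).mpr hHle
    rw [hsa.norm_mul_self] at h3
    exact (sq_le_one_iff₀ (norm_nonneg _)).mp h3
  have hdecomp : A = U * H * (B * H * Uᴴ) := by
    calc A = R * Rᴴ := by rw [hR.1.eq, hRR]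
      _ = K * S * (S * Kᴴ) := by
        rw [← hKS, Matrix.conjTranspose_mul, hS.1.eq]
      _ = K * (S * S) * Kᴴ := by simp only [Matrix.mul_assoc]
      _ = _ := by simp only [hSS, ← hHU, hUH, Matrix.mul_assoc]
  have hc := unitarilyInvariant_selfAdjoint_contraction_mul_le hN_add hN_smul hN_unitary hsa hnorm
  calc N A = N (U * H * (B * H * Uᴴ)) := congrArg N hdecomp
    _ ≤ N (B * H * Uᴴ) := (hc _ U hU).1
    _ ≤ N B := (hc _ Uᴴ hU').2

theorem unitarilyInvariant_nonneg
    (hN_add : ∀ A B, N (A + B) ≤ N A + N B)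
    (hN_smul : ∀ (c : ℂ) A, N (c • A) = ‖c‖ * N A) (A : Matrix (Fin n) (Fin n) ℂ) : 0 ≤ N A := by
  have h0 := hN_smul 0 0
  have h1 := hN_smul (-1) A
  have h2 := hN_add A ((-1 : ℂ) • A)
  simp only [norm_zero, zero_mul, smul_zero] at h0
  simp only [neg_smul, one_smul, norm_neg, norm_one, one_mul, add_neg_cancel] at h1 h2
  linarith

theorem unitarilyInvariant_le_of_posSemidef
    (hN_add : ∀ A B, N (A + B) ≤ N A + N B)
    (hN_smul : ∀ (c : ℂ) A, N (c • A) = ‖c‖ * N A)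
    (hN_unitary : ∀ (A U V : Matrix (Fin n) (Fin n) ℂ),
      U ∈ Matrix.unitaryGroup (Fin n) ℂ → V ∈ Matrix.unitaryGroup (Fin n) ℂ →
      N (U * A * V) = N A)
    {A B : Matrix (Fin n) (Fin n) ℂ} (hA : A.PosSemidef) (hAB : (B - A).PosSemidef) :
    N A ≤ N B := by
  have hB : B.PosSemidef := by simpa using hA.add hAB
  have key : ∀ ε : ℝ, 0 < ε → N A ≤ N B + ε * (2 * N 1) := by
    intro ε hε
    have hE : ((ε : ℂ) • (1 : Matrix (Fin n) (Fin n) ℂ)).PosDef :=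
      Matrix.PosDef.one.smul (by exact_mod_cast hε)
    have h1 := unitarilyInvariant_le_of_posDef hN_add hN_smul hN_unitary
      (hE.posSemidef_add hA) (hE.posSemidef_add hB) (by simpa using hAB)
    have h2 := hN_add (A + (ε : ℂ) • 1) ((-ε : ℂ) • 1)
    have h3 := hN_add B ((ε : ℂ) • 1)
    rw [hN_smul] at h2 h3
    simp only [neg_smul, add_neg_cancel_right, norm_neg, Complex.norm_real, Real.norm_eq_abs,
      abs_of_pos hε] at h2 h3
    linarith
  have h1 := unitarilyInvariant_nonneg hN_add hN_smul 1
  refine le_of_forall_pos_le_add fun η hη => ?_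
  have h2 := key (η / (2 * N 1 + 1)) (by positivity)
  have h3 : η / (2 * N 1 + 1) * (2 * N 1) ≤ η := by
    rw [div_mul_eq_mul_div, div_le_iff₀ (by positivity)]
    nlinarith
  linarith

/-- The arithmetic-geometric mean inequality for a unitarily invariant norm and an off-diagonal
block `X`; the hypothesis `h` holds whenever the block matrix `[[P, X], [Xᴴ, Q]]` is positive
semidefinite. -/
theorem unitarilyInvariant_two_mul_le_add
    (hN_add : ∀ A B, N (A + B) ≤ N A + N B)
    (hN_smul : ∀ (c : ℂ) A, N (c • A) = ‖c‖ * N A)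
    (hN_unitary : ∀ (A U V : Matrix (Fin n) (Fin n) ℂ),
      U ∈ Matrix.unitaryGroup (Fin n) ℂ → V ∈ Matrix.unitaryGroup (Fin n) ℂ →
      N (U * A * V) = N A)
    {P Q X : Matrix (Fin n) (Fin n) ℂ}
    (h : ∀ U ∈ Matrix.unitaryGroup (Fin n) ℂ,
      (Uᴴ * P * U + Q - (Uᴴ * X + Xᴴ * U)).PosSemidef) :
    2 * N X ≤ N P + N Q := by
  have of_unit : ∀ {P Q X : Matrix (Fin n) (Fin n) ℂ}, IsUnit X →
      (∀ U ∈ Matrix.unitaryGroup (Fin n) ℂ,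
        (Uᴴ * P * U + Q - (Uᴴ * X + Xᴴ * U)).PosSemidef) → 2 * N X ≤ N P + N Q := by
    intro P Q X hX h
    obtain ⟨U, hU, hH⟩ := Matrix.exists_unitary_posSemidef_of_isUnit hX
    have hU' : Uᴴ ∈ Matrix.unitaryGroup (Fin n) ℂ := Unitary.star_mem hU
    have hXU : Xᴴ * U = Uᴴ * X := by
      simpa only [Matrix.conjTranspose_mul, Matrix.conjTranspose_conjTranspose] using hH.1.eq
    have h1 := h U hU
    rw [hXU] at h1
    have h2 := unitarilyInvariant_le_of_posSemidef hN_add hN_smul hN_unitary (hH.add hH) h1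
    have h3 := hN_unitary X Uᴴ 1 hU' (one_mem _)
    have h4 := hN_smul 2 (Uᴴ * X)
    rw [two_smul] at h4
    rw [Matrix.mul_one] at h3
    have h5 := hN_add (Uᴴ * P * U) Q
    rw [hN_unitary P Uᴴ U hU' hU] at h5
    rw [h3, Complex.norm_two] at h4
    linarith
  have key : ∀ ε : ℝ, 0 < ε → 2 * N X ≤ N P + N Q + ε * (4 * N 1) := by
    intro ε hε
    obtain ⟨δ, hδ, hδε, hunit⟩ := Matrix.exists_pos_lt_isUnit_add_smul_one X hε
    have h1 : 2 * N (X + (δ : ℂ) • 1) ≤ N (P + (δ : ℂ) • 1) + N (Q + (δ : ℂ) • 1) := by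
      refine of_unit hunit fun U hU => ?_
      have hUU : Uᴴ * U = 1 := Matrix.mem_unitaryGroup_iff'.mp hU
      have h2 : ((δ : ℂ) • ((U - 1)ᴴ * (U - 1))).PosSemidef :=
        (Matrix.posSemidef_conjTranspose_mul_self (U - 1)).smul (by exact_mod_cast hδ.le)
      convert (h U hU).add h2 using 1
      simp only [Matrix.conjTranspose_add, Matrix.conjTranspose_sub, Matrix.conjTranspose_smul,
        Matrix.conjTranspose_one, Matrix.mul_add, Matrix.add_mul, Matrix.mul_sub, Matrix.sub_mul,
        Matrix.mul_smul, Matrix.smul_mul, Matrix.mul_one, Matrix.one_mul, hUU, RCLike.star_def,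
        Complex.conj_ofReal]
      module
    have h2 := hN_add (X + (δ : ℂ) • 1) ((-δ : ℂ) • 1)
    have h3 := hN_add P ((δ : ℂ) • 1)
    have h4 := hN_add Q ((δ : ℂ) • 1)
    rw [hN_smul] at h2 h3 h4
    simp only [neg_smul, add_neg_cancel_right, norm_neg, Complex.norm_real, Real.norm_eq_abs,
      abs_of_pos hδ] at h2 h3 h4
    have h5 := mul_le_mul_of_nonneg_right hδε.le (unitarilyInvariant_nonneg hN_add hN_smul 1)
    linarith
  have h1 := unitarilyInvariant_nonneg hN_add hN_smul 1
  refine le_of_forall_pos_le_add fun η hη => ?_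
  have h2 := key (η / (4 * N 1 + 1)) (by positivity)
  have h3 : η / (4 * N 1 + 1) * (4 * N 1) ≤ η := by
    rw [div_mul_eq_mul_div, div_le_iff₀ (by positivity)]
    nlinarith
  linarith

theorem le_sqrt_mul_sqrt_of_forall_two_mul_le {m p q : ℝ} (hm : 0 ≤ m) (hp : 0 ≤ p) (hq : 0 ≤ q)
    (h : ∀ r : ℝ, 0 < r → 2 * m ≤ r ^ 2 * p + (r⁻¹) ^ 2 * q) : m ≤ √p * √q := by
  rw [← Real.sqrt_mul hp]
  refine Real.le_sqrt_of_sq_le ?_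
  have hquad : ∀ s : ℝ, 0 ≤ p * (s * s) + (-2 * m) * s + q := by
    intro s
    rcases le_or_gt s 0 with hs | hs
    · nlinarith [mul_nonneg hp (mul_self_nonneg s), mul_nonneg hm (neg_nonneg.mpr hs)]
    · have h1 := h √s (Real.sqrt_pos.mpr hs)
      rw [inv_pow, Real.sq_sqrt hs.le] at h1
      have h2 := mul_le_mul_of_nonneg_left h1 hs.le
      have h3 : s * (s * p + s⁻¹ * q) = p * (s * s) + q := by field_simp
      linarith
  have := discrim_le_zero hquad
  rw [discrim] at this
  linarith

/-- The Cauchy-Schwarz inequality for a unitarily invariant norm, for columns of two blocks. -/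
theorem unitarilyInvariant_add_le_sqrt_mul_sqrt
    (hN_add : ∀ A B, N (A + B) ≤ N A + N B)
    (hN_smul : ∀ (c : ℂ) A, N (c • A) = ‖c‖ * N A)
    (hN_unitary : ∀ (A U V : Matrix (Fin n) (Fin n) ℂ),
      U ∈ Matrix.unitaryGroup (Fin n) ℂ → V ∈ Matrix.unitaryGroup (Fin n) ℂ →
      N (U * A * V) = N A)
    (a b c d : Matrix (Fin n) (Fin n) ℂ) :
    N (aᴴ * c + bᴴ * d) ≤ √(N (aᴴ * a + bᴴ * b)) * √(N (cᴴ * c + dᴴ * d)) := by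
  have hnn := unitarilyInvariant_nonneg hN_add hN_smul
  refine le_sqrt_mul_sqrt_of_forall_two_mul_le (hnn _) (hnn _) (hnn _) fun r hr => ?_
  have hscale : ∀ (s : ℝ) (A : Matrix (Fin n) (Fin n) ℂ),
      N (((s : ℂ) ^ 2) • A) = s ^ 2 * N A := by
    intro s A
    rw [hN_smul, norm_pow, Complex.norm_real, Real.norm_eq_abs, sq_abs]
  rw [← hscale, ← hscale]
  refine unitarilyInvariant_two_mul_le_add hN_add hN_smul hN_unitary fun U _ => ?_
  have hr1 : (r : ℂ) * ((r⁻¹ : ℝ) : ℂ) = 1 := by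
    exact_mod_cast mul_inv_cancel₀ hr.ne'
  have hpsd := (Matrix.posSemidef_conjTranspose_mul_self
      ((r : ℂ) • (a * U) - ((r⁻¹ : ℝ) : ℂ) • c)).add (Matrix.posSemidef_conjTranspose_mul_self
      ((r : ℂ) • (b * U) - ((r⁻¹ : ℝ) : ℂ) • d))
  convert hpsd using 1
  simp only [Matrix.conjTranspose_add, Matrix.conjTranspose_sub, Matrix.conjTranspose_smul,
    Matrix.conjTranspose_mul, Matrix.conjTranspose_conjTranspose, Matrix.mul_add, Matrix.add_mul,
    Matrix.mul_sub, Matrix.sub_mul, Matrix.mul_smul, Matrix.smul_mul, RCLike.star_def,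
    Complex.conj_ofReal, smul_smul, smul_add, smul_sub, hr1, mul_comm ((r⁻¹ : ℝ) : ℂ) (r : ℂ),
    one_smul, pow_two, Matrix.mul_assoc]
  abel

end UnitarilyInvariant

theorem stmt6 {n : ℕ} (x y : Matrix (Fin n) (Fin n) ℂ)
    (hx : x.PosSemidef) (hy : y.PosSemidef)
    (N : Matrix (Fin n) (Fin n) ℂ → ℝ)
    (hN_add : ∀ A B, N (A + B) ≤ N A + N B)
    (hN_smul : ∀ (c : ℂ) A, N (c • A) = ‖c‖ * N A)
    (hN_zero : ∀ A, N A = 0 ↔ A = 0)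
    (hN_unitary : ∀ (A U V : Matrix (Fin n) (Fin n) ℂ),
      U ∈ Matrix.unitaryGroup (Fin n) ℂ → V ∈ Matrix.unitaryGroup (Fin n) ℂ →
      N (U * A * V) = N A)
    (z : Matrix (Fin n) (Fin n) ℂ)
    (hz : ‖Matrix.toEuclideanCLM (𝕜 := ℂ) z‖ ≤ 1)
    (t : ℝ) (ht : t ∈ Set.Icc (1/2 : ℝ) 1) :
    N (psdPow x t * z * psdPow y (1 - t) + psdPow y t * zᴴ * psdPow x (1 - t)) ≤
      Real.sqrt (N (x + y)) *
        Real.sqrt (N (psdPow y (1 - t) * zᴴ * psdPow x (2*t - 1) * z * psdPow y (1 - t) +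
      psdPow x (1 - t) * z * psdPow y (2*t - 1) * zᴴ * psdPow x (1 - t))) := by
  obtain ⟨ht1, ht2⟩ := ht
  have hhalf : ∀ {w : Matrix (Fin n) (Fin n) ℂ}, w.PosSemidef →
      psdPow w (1 / 2) * psdPow w (1 / 2) = w := fun hw => by
    rw [psdPow_mul_psdPow_s6 hw (by norm_num) (by norm_num), add_halves, psdPow_one_s6 hw]
  have htop : ∀ {w : Matrix (Fin n) (Fin n) ℂ}, w.PosSemidef →
      psdPow w (1 / 2) * psdPow w (t - 1 / 2) = psdPow w t := fun hw => by
    rw [psdPow_mul_psdPow_s6 hw (by norm_num) (by linarith), add_sub_cancel]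
  have hmid : ∀ {w : Matrix (Fin n) (Fin n) ℂ}, w.PosSemidef →
      psdPow w (t - 1 / 2) * psdPow w (t - 1 / 2) = psdPow w (2 * t - 1) := fun hw => by
    rw [psdPow_mul_psdPow_s6 hw (by linarith) (by linarith)]
    congr 1
    ring
  have hcs := unitarilyInvariant_add_le_sqrt_mul_sqrt hN_add hN_smul hN_unitary
    (psdPow x (1 / 2)) (psdPow y (1 / 2))
    (psdPow x (t - 1 / 2) * (z * psdPow y (1 - t)))
    (psdPow y (t - 1 / 2) * (zᴴ * psdPow x (1 - t)))
  have hassoc : ∀ {w : Matrix (Fin n) (Fin n) ℂ} (_ : w.PosSemidef)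
      (A B : Matrix (Fin n) (Fin n) ℂ),
      A * psdPow w (t - 1 / 2) * (psdPow w (t - 1 / 2) * B) = A * psdPow w (2 * t - 1) * B :=
    fun hw A B => by simp only [← hmid hw, Matrix.mul_assoc]
  simp only [Matrix.conjTranspose_mul, psdPow_conjTranspose, Matrix.conjTranspose_conjTranspose,
    hhalf hx, hhalf hy, hassoc hx, hassoc hy] at hcs
  simpa only [← Matrix.mul_assoc, htop hx, htop hy] using hcs
end
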